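/- arXiv:1004.4690 — 3 statements merged into one kernel-verified Lean document; each statement's English description precedes it below -/
import Mathlib

section
/- Let n be a positive integer, d a finite index set partitioned into two disjoint nonempty subsets d1 and d2, and Y_j : Fin n → Bool for j ∈ d. Define n_{k1}(1) := |{u : Y_j u = true for some j ∈ d1}|, n_{k2}(1) := |{u : Y_j u = true for some j ∈ d2}|, n_k(1) := |{u : Y_j u = true for some j ∈ d}|, and b := |{u : (Y_j u = true for some j ∈ d1) and (Y_j u = true for some j ∈ d2)}|. Then (as integers) n_{k1}(1) + n_{k2}(1) − n_k(1) = b. Moreover, if n_{k1}(1) > 0, n_{k2}(1) > 0 and b > 0, then := (n_{k1}(1)·n_{k2}(1))/(n·b) is a positive real number satisfying 1 − γ̂_k/Â = (1 − γ̂_{k1}/Â)·(1 − γ̂_{k2}/Â), where γ̂_k := n_k(1)/n, γ̂_{k1} := n_{k1}(1)/n, γ̂_{k2} := n_{k2}(1)/n. -/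
/-- Theorem 2 of the paper (the explicit MLE estimator) stated on observed data: the child
subtrees of node `k` are divided into two disjoint nonempty groups `d1, d2`; `Y j u` records
whether probe `u` was observed in subtree `j`. Then `n_{k1}(1) + n_{k2}(1) − n_k(1)` equals the
number `b` of probes observed in both merged groups, and when the counts are positive the
estimate `Â = n_{k1}(1)·n_{k2}(1)/(n·b)` is positive and exactly solves the merged two-factor
likelihood equation. -/
theorem stmt4 (n : ℕ) (hn : 0 < n)
    (d : Type) [Fintype d]
    (d1 d2 : Finset d) (h1 : d1.Nonempty) (h2 : d2.Nonempty)
    (hdisj : Disjoint d1 d2) (hunion : ∀ j : d, j ∈ d1 ∨ j ∈ d2)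
    (Y : d → Fin n → Bool) :
    let nk1 : ℕ := (Finset.univ.filter (fun u : Fin n => ∃ j ∈ d1, Y j u = true)).card;
    let nk2 : ℕ := (Finset.univ.filter (fun u : Fin n => ∃ j ∈ d2, Y j u = true)).card;
    let nk : ℕ := (Finset.univ.filter (fun u : Fin n => ∃ j : d, Y j u = true)).card;
    let b : ℕ := (Finset.univ.filter (fun u : Fin n =>
        (∃ j ∈ d1, Y j u = true) ∧ ∃ j ∈ d2, Y j u = true)).card;
    ((nk1 : ℤ) + (nk2 : ℤ) - (nk : ℤ) = (b : ℤ)) ∧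
      (0 < nk1 → 0 < nk2 → 0 < b →
        let Ahat : ℝ := ((nk1 : ℝ) * (nk2 : ℝ)) / ((n : ℝ) * (b : ℝ));
        0 < Ahat ∧
          1 - ((nk : ℝ) / n) / Ahat =
            (1 - ((nk1 : ℝ) / n) / Ahat) * (1 - ((nk2 : ℝ) / n) / Ahat)) := by
  intro nk1 nk2 nk b
  have hcount : nk + b = nk1 + nk2 := by
    have hor : (Finset.univ.filter (fun u : Fin n => ∃ j : d, Y j u = true)) =
        Finset.univ.filter (fun u : Fin n => ∃ j ∈ d1, Y j u = true) ∪
          Finset.univ.filter (fun u : Fin n => ∃ j ∈ d2, Y j u = true) := by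
      ext u
      simp only [Finset.mem_union, Finset.mem_filter, Finset.mem_univ, true_and]
      constructor
      · rintro ⟨j, hj⟩
        exact (hunion j).imp (fun h => ⟨j, h, hj⟩) (fun h => ⟨j, h, hj⟩)
      · rintro (⟨j, -, hj⟩ | ⟨j, -, hj⟩) <;> exact ⟨j, hj⟩
    simp only [nk, nk1, nk2, b]
    rw [hor, Finset.filter_and, Finset.card_union_add_card_inter]
  clear_value nk1 nk2 nk b
  refine ⟨by omega, fun hk1 hk2 hb => ?_⟩
  intro Ahat
  have hn' : (0 : ℝ) < n := by exact_mod_cast hn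
  have hk1' : (0 : ℝ) < nk1 := by exact_mod_cast hk1
  have hk2' : (0 : ℝ) < nk2 := by exact_mod_cast hk2
  have hb' : (0 : ℝ) < b := by exact_mod_cast hb
  have hnk : (nk : ℝ) = nk1 + nk2 - b := by
    rw [eq_sub_iff_add_eq]
    exact_mod_cast hcount
  refine ⟨by positivity, ?_⟩
  simp only [Ahat]
  rw [hnk]
  field_simp
  ring
end

section
/- Let A > 0 be a real number, d a finite index set partitioned into two disjoint nonempty subsets d1 and d2, and β : d → ℝ with 0 < β_j < 1 for all j ∈ d. Define γ_{k1} := A·(1 − ∏_{j ∈ d1} (1 − β_j)), γ_{k2} := A·(1 − ∏_{j ∈ d2} (1 − β_j)), and γ_k := A·(1 − ∏_{j ∈ d} (1 − β_j)). Then γ_{k1} + γ_{k2} − γ_k = γ_{k1}·γ_{k2}/A > 0, and consequently (γ_{k1}·γ_{k2})/(γ_{k1} + γ_{k2} − γ_k) = A. -/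
/-- A nonempty product of factors `1 - β j` with `0 < β j < 1` is less than one. -/
theorem prod_one_sub_lt_one {ι : Type*} {s : Finset ι} (hs : s.Nonempty) {β : ι → ℝ}
    (hβ : ∀ j ∈ s, 0 < β j ∧ β j < 1) : ∏ j ∈ s, (1 - β j) < 1 := by
  calc ∏ j ∈ s, (1 - β j) < ∏ _j ∈ s, (1 : ℝ) :=
        Finset.prod_lt_prod_of_nonempty (fun j hj => sub_pos.2 (hβ j hj).2)
          (fun j hj => sub_lt_self 1 (hβ j hj).1) hs
    _ = 1 := Finset.prod_const_one

/-- Model-level form of Theorem 2 (the explicit MLE estimator): in the Bernoulli multicast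
loss model, with path pass rate `A > 0` and conditional observation probabilities
`0 < β_j < 1`, merging the children into two disjoint nonempty groups `d1, d2` with group
observation rates `γ_{k1}, γ_{k2}` and whole-subtree rate `γ_k`, one has
`γ_{k1} + γ_{k2} − γ_k = γ_{k1} γ_{k2}/A > 0` and the explicit formula
`γ_{k1} γ_{k2}/(γ_{k1} + γ_{k2} − γ_k)` recovers `A` exactly. -/
theorem stmt5 (A : ℝ) (hA : 0 < A)
    (d : Type) [Fintype d] [DecidableEq d]
    (d1 d2 : Finset d) (h1 : d1.Nonempty) (h2 : d2.Nonempty)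
    (hunion : d1 ∪ d2 = Finset.univ) (hdisj : d1 ∩ d2 = ∅)
    (β : d → ℝ) (hβ : ∀ j : d, 0 < β j ∧ β j < 1) :
    let γk1 : ℝ := A * (1 - ∏ j ∈ d1, (1 - β j));
    let γk2 : ℝ := A * (1 - ∏ j ∈ d2, (1 - β j));
    let γk : ℝ := A * (1 - ∏ j : d, (1 - β j));
    γk1 + γk2 - γk = γk1 * γk2 / A ∧
      0 < γk1 * γk2 / A ∧
      γk1 * γk2 / (γk1 + γk2 - γk) = A := by
  intro γk1 γk2 γk
  have hprod : ∏ j : d, (1 - β j) = (∏ j ∈ d1, (1 - β j)) * ∏ j ∈ d2, (1 - β j) := by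
    rw [← hunion, Finset.prod_union (Finset.disjoint_iff_inter_eq_empty.2 hdisj)]
  have hpos1 : 0 < γk1 :=
    mul_pos hA (sub_pos.2 (prod_one_sub_lt_one h1 fun j _ => hβ j))
  have hpos2 : 0 < γk2 :=
    mul_pos hA (sub_pos.2 (prod_one_sub_lt_one h2 fun j _ => hβ j))
  have heq : γk1 + γk2 - γk = γk1 * γk2 / A := by
    rw [eq_div_iff hA.ne']
    simp only [γk1, γk2, γk, hprod]
    ring
  refine ⟨heq, by positivity, ?_⟩
  rw [heq, div_div_cancel₀ (mul_pos hpos1 hpos2).ne']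
end

section
/- Let d be a finite index set with |d| ≥ 2, γ : d → ℝ with 0 < γ_j < 1 for all j ∈ d, and γ_k ∈ (0,1) such that max_{j ∈ d} γ_j < γ_k < Σ_{j ∈ d} γ_j and ∏_{j ∈ d} (1 − γ_j) < 1 − γ_k. Then there exists exactly one real number A with γ_k < A < 1 satisfying 1 − γ_k/A = ∏_{j ∈ d} (1 − γ_j/A). -/
open Set

/-- On an interval where all the factors `1 - c i * x` with `0 ≤ c i` are nonnegative, their product
is convex and antitone. -/
theorem convexOn_antitoneOn_prod_one_sub_mul {ι : Type*} (t : Finset ι) (c : ι → ℝ) (s : Set ℝ)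
    (hs : Convex ℝ s) (hc : ∀ i, 0 ≤ c i) (hcs : ∀ i, ∀ x ∈ s, 0 ≤ 1 - c i * x) :
    ConvexOn ℝ s (fun x => ∏ i ∈ t, (1 - c i * x)) ∧
      AntitoneOn (fun x => ∏ i ∈ t, (1 - c i * x)) s := by
  classical
  induction t using Finset.induction_on with
  | empty => exact ⟨by simpa using convexOn_const (1 : ℝ) hs, by simpa using antitoneOn_const⟩
  | insert a t ha ih =>
    have hanti : AntitoneOn (fun x => 1 - c a * x) s := fun x _ y _ hxy =>
      sub_le_sub_left (mul_le_mul_of_nonneg_left hxy (hc a)) 1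
    have hconv : ConvexOn ℝ s (fun x => 1 - c a * x) :=
      ⟨hs, fun x _ y _ p q _ _ hpq => by simp only [smul_eq_mul]; linear_combination -hpq⟩
    have hnonneg : ∀ x ∈ s, 0 ≤ ∏ i ∈ t, (1 - c i * x) := fun x hx =>
      Finset.prod_nonneg fun i _ => hcs i x hx
    simp only [Finset.prod_insert ha]
    refine ⟨hconv.mul ih.1 (fun x hx => hcs a x hx) (fun x hx => hnonneg x hx)
      (hanti.monovaryOn ih.2), fun x hx y hy hxy => ?_⟩
    exact mul_le_mul (hanti hx hy hxy) (ih.2 hx hy hxy) (hnonneg y hy) (hcs a x hx)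

/-- A convex function that is negative at `a` has at most one zero to the right of `a`. -/
theorem ConvexOn.eq_of_eq_zero_of_neg {s : Set ℝ} {f : ℝ → ℝ} (hf : ConvexOn ℝ s f) {a x y : ℝ}
    (ha : a ∈ s) (hx : x ∈ s) (hy : y ∈ s) (hfa : f a < 0) (hax : a < x) (hay : a < y)
    (hfx : f x = 0) (hfy : f y = 0) : x = y := by
  have key : ∀ u v, v ∈ s → a < u → f u = 0 → f v = 0 → ¬ u < v := by
    intro u v hv hau hfu hfv huv
    have hmem : u ∈ openSegment ℝ a v := by
      rw [openSegment_eq_Ioo (hau.trans huv)]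
      exact ⟨hau, huv⟩
    have := hf.lt_right_of_left_lt ha hv hmem (by rwa [hfu])
    linarith
  exact le_antisymm (not_lt.1 (key y x hx hay hfy hfx)) (not_lt.1 (key x y hy hax hfx hfy))

/-- Uniqueness lemma for the multicast likelihood equation (Lemma 1 of Cáceres et al.,
invoked by the paper): under the data-consistency conditions `0 < γ_j < 1`,
`max_j γ_j < γ_k < Σ_j γ_j` and `∏_j (1 − γ_j) < 1 − γ_k`, the likelihood equation
`1 − γ_k/A = ∏_{j ∈ d} (1 − γ_j/A)` has one and only one root `A` in `(γ_k, 1)`. -/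
theorem stmt12 (d : Type) [Fintype d] (hd : 2 ≤ Fintype.card d)
    (γ : d → ℝ) (hγ : ∀ j : d, 0 < γ j ∧ γ j < 1)
    (γk : ℝ) (hγk0 : 0 < γk) (hγk1 : γk < 1)
    (hmax : ∀ j : d, γ j < γk) (hsum : γk < ∑ j : d, γ j)
    (hprod : ∏ j : d, (1 - γ j) < 1 - γk) :
    ∃! A : ℝ, (γk < A ∧ A < 1) ∧ 1 - γk / A = ∏ j : d, (1 - γ j / A) := by
  set f : ℝ → ℝ := fun x => (∏ j : d, (1 - γ j * x)) + (γk * x - 1) with hf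
  have h1 : 1 < γk⁻¹ := (one_lt_inv₀ hγk0).2 hγk1
  have hfac : ∀ j, ∀ x ∈ Icc 1 γk⁻¹, 0 ≤ 1 - γ j * x := by
    intro j x hx
    have h2 : γ j * x ≤ γk * γk⁻¹ :=
      mul_le_mul (hmax j).le hx.2 (by linarith [hx.1]) hγk0.le
    rw [mul_inv_cancel₀ hγk0.ne'] at h2
    linarith
  have hconv : ConvexOn ℝ (Icc 1 γk⁻¹) f :=
    (convexOn_antitoneOn_prod_one_sub_mul Finset.univ γ _ (convex_Icc _ _)
      (fun j => (hγ j).1.le) hfac).1.add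
      ⟨convex_Icc _ _, fun x _ y _ p q _ _ hpq => by
        simp only [smul_eq_mul]; linear_combination hpq⟩
  have hf1 : f 1 < 0 := by
    simp only [hf, mul_one]
    linarith
  have hfk : 0 < f γk⁻¹ := by
    simp only [hf, mul_inv_cancel₀ hγk0.ne', sub_self, add_zero]
    refine Finset.prod_pos fun j _ => ?_
    rw [← div_eq_mul_inv, sub_pos, div_lt_one hγk0]
    exact hmax j
  have hcont : ContinuousOn f (Icc 1 γk⁻¹) := by
    simp only [hf]
    fun_prop
  have hroot : ∀ A, 1 - γk / A = ∏ j : d, (1 - γ j / A) ↔ f A⁻¹ = 0 := by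
    intro A
    simp only [hf, div_eq_mul_inv]
    constructor <;> intro h <;> linarith
  have hmem : ∀ A, γk < A → A < 1 → 1 < A⁻¹ ∧ A⁻¹ ∈ Icc 1 γk⁻¹ := by
    intro A hA hA1
    have h2 : 1 < A⁻¹ := (one_lt_inv₀ (hγk0.trans hA)).2 hA1
    exact ⟨h2, h2.le, inv_anti₀ hγk0 hA.le⟩
  obtain ⟨x, ⟨hx1, hxk⟩, hx0⟩ := intermediate_value_Ioo h1.le hcont ⟨hf1, hfk⟩
  refine ⟨x⁻¹, ⟨⟨(lt_inv_comm₀ (by linarith) hγk0).1 hxk, inv_lt_one_of_one_lt₀ hx1⟩,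
    (hroot _).2 (by rwa [inv_inv])⟩, ?_⟩
  rintro A ⟨⟨hA, hA1⟩, hAeq⟩
  obtain ⟨h2, h3⟩ := hmem A hA hA1
  rw [← hconv.eq_of_eq_zero_of_neg (left_mem_Icc.2 h1.le) h3 ⟨hx1.le, hxk.le⟩ hf1 h2 hx1
    ((hroot A).1 hAeq) hx0, inv_inv]
end
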